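/- arXiv:2005.02646 — 4 statements merged into one kernel-verified Lean document; each statement's English description precedes it below -/
import Mathlib

section
/- Let T_s > 0 be the sampling period and let c_min satisfy -1/T_s ≤ c_min < 0, with c_w ≥ c_min for every mode w ∈ W. Under the linear state feedback u = Kx with K = (0, c_min, 0), the set R_K = {x ∈ ℝ³ : a_min/c_min ≥ x₂ ≥ 0, x₃ ≥ x₂, v_max ≥ x₂, x₁ ≥ 0} is robustly positively invariant for the dynamics f: for every x ∈ R_K and every mode w ∈ W, the successor state f(x, Kx, w) lies in R_K. -/
open scoped BigOperators

/-- Longitudinal dynamics of the vehicle pair: state `x = (headway, ego velocity,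
target velocity)`, input `u` (ego acceleration), mode `w` with parameter `c w`.
The target acceleration is `c w` if `c w ≥ 0` and `c w * x₃` otherwise. -/
noncomputable def dyn {M : ℕ} (Ts : ℝ) (c : Fin M → ℝ) (x : ℝ × ℝ × ℝ) (u : ℝ) (w : Fin M) : ℝ × ℝ × ℝ :=
  (x.1 + Ts * (x.2.2 - x.2.1), x.2.1 + Ts * u,
    x.2.2 + Ts * (if 0 ≤ c w then c w else c w * x.2.2))

/-- The candidate robust positively invariant set
`R_K = {x : a_min/c_min ≥ x₂ ≥ 0, x₃ ≥ x₂, v_max ≥ x₂, x₁ ≥ 0}`. -/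
def RK (amin cmin vmax : ℝ) : Set (ℝ × ℝ × ℝ) :=
  {x | x.2.1 ≤ amin / cmin ∧ 0 ≤ x.2.1 ∧ x.2.1 ≤ x.2.2 ∧ x.2.1 ≤ vmax ∧ 0 ≤ x.1}

/-- Under the feedback `u = Kx = c_min · x₂`, the set `R_K` is robustly positively
invariant: every successor state `f(x, Kx, w)` stays in `R_K`. -/
theorem rk_robust_positively_invariant {M : ℕ} (Ts cmin amin amax vmax : ℝ)
    (c : Fin M → ℝ)
    (hTs : 0 < Ts) (hc1 : -(1 / Ts) ≤ cmin) (hc2 : cmin < 0)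
    (hcw : ∀ w : Fin M, cmin ≤ c w)
    (hamin : amin ≤ 0) (hamax : 0 ≤ amax) (hvmax : 0 < vmax)
    (x : ℝ × ℝ × ℝ) (hx : x ∈ RK amin cmin vmax) (w : Fin M) :
    dyn Ts c x (cmin * x.2.1) w ∈ RK amin cmin vmax := by
  obtain ⟨x₁, x₂, x₃⟩ := x
  obtain ⟨hbound, hnonneg, hle, hmax, hheadway⟩ := hx
  dsimp only at hbound hnonneg hle hmax hheadway
  have hgain : 0 ≤ 1 + Ts * cmin := by
    have h := mul_le_mul_of_nonneg_left hc1 hTs.le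
    rw [mul_neg, mul_one_div_cancel hTs.ne'] at h
    linarith
  have hdecr : Ts * (cmin * x₂) ≤ 0 :=
    mul_nonpos_of_nonneg_of_nonpos hTs.le (mul_nonpos_of_nonpos_of_nonneg hc2.le hnonneg)
  have hego : 0 ≤ x₂ + Ts * (cmin * x₂) := by
    linarith [mul_nonneg hgain hnonneg]
  have hsep : x₂ + Ts * (cmin * x₂) ≤ x₃ + Ts * (if 0 ≤ c w then c w else c w * x₃) := by
    split_ifs with hw
    · linarith [mul_nonneg hTs.le hw]
    · have hmode : Ts * (cmin * x₃) ≤ Ts * (c w * x₃) := by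
        gcongr
        · exact hnonneg.trans hle
        · exact hcw w
      linarith [mul_le_mul_of_nonneg_left hle hgain]
  have hhead : 0 ≤ x₁ + Ts * (x₃ - x₂) :=
    add_nonneg hheadway (mul_nonneg hTs.le (sub_nonneg.mpr hle))
  exact ⟨by dsimp only [dyn]; linarith, hego, hsep, by dsimp only [dyn]; linarith, hhead⟩
end

section
/- Let T_s > 0, let c_min satisfy -1/T_s ≤ c_min < 0 with c_w ≥ c_min for all w ∈ W, and let δ ∈ (0, 1]. For every x in R_K = {x ∈ ℝ³ : a_min/c_min ≥ x₂ ≥ 0, x₃ ≥ x₂, v_max ≥ x₂, x₁ ≥ 0} and every w ∈ W: x belongs to X_r = {x : 0 ≤ x₂ ≤ v_max}, and there exists u ∈ U = [a_min, a_max] (namely u = c_min·x₂) such that for every probability vector p on W, AVaR_δ^p applied to the vector (g(f(x, u, w')))_{w' ∈ W} is at most 0, where g(x) = −x₁. In particular R_K × W is contained in the stochastic feasibility set Z_s. -/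
open scoped BigOperators

/-- Hard state constraint set `X_r = {x : 0 ≤ x₂ ≤ v_max}`. -/
def Xr (vmax : ℝ) : Set (ℝ × ℝ × ℝ) := {x | 0 ≤ x.2.1 ∧ x.2.1 ≤ vmax}

/-- Input constraint set `U = [a_min, a_max]`. -/
def Uset (amin amax : ℝ) : Set ℝ := {u | amin ≤ u ∧ u ≤ amax}

/-- Constraint function `g(x) = -x₁` (negative headway). -/
def gcon (x : ℝ × ℝ × ℝ) : ℝ := -x.1

/-- Probability simplex `Δ_n`. -/
def simplex (n : ℕ) : Set (Fin n → ℝ) := {p | (∑ i, p i) = 1 ∧ ∀ i, 0 ≤ p i}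

/-- Average value-at-risk at level `δ` with reference probability `p`, in its dual
representation `AVaR_δ^p[z] = max{μᵀz : Σ μᵢ = 1, 0 ≤ μ ≤ p/δ}`. -/
noncomputable def avar {n : ℕ} (δ : ℝ) (p : Fin n → ℝ) (z : Fin n → ℝ) : ℝ :=
  sSup {v | ∃ μ : Fin n → ℝ, (∑ i, μ i) = 1 ∧ (∀ i, 0 ≤ μ i ∧ μ i ≤ p i / δ) ∧
    v = ∑ i, μ i * z i}

/-- Stochastic feasibility set `Z_s` for a row-stochastic transition matrix `P`. -/
noncomputable def Zs {M : ℕ} (Ts : ℝ) (c : Fin M → ℝ) (amin amax vmax δ : ℝ)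
    (P : Fin M → Fin M → ℝ) : Set ((ℝ × ℝ × ℝ) × Fin M) :=
  {q | q.1 ∈ Xr vmax ∧ ∃ u ∈ Uset amin amax,
    avar δ (P q.2) (fun w' => gcon (dyn Ts c q.1 u w')) ≤ 0}

/-- The average value-at-risk of a pointwise nonpositive vector is nonpositive. -/
theorem avar_nonpos {n : ℕ} (δ : ℝ) (p : Fin n → ℝ) {z : Fin n → ℝ} (hz : ∀ i, z i ≤ 0) :
    avar δ p z ≤ 0 := by
  refine Real.sSup_nonpos ?_
  rintro v ⟨μ, -, hμ, rfl⟩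
  exact Finset.sum_nonpos fun i _ => mul_nonpos_of_nonneg_of_nonpos (hμ i).1 (hz i)

/-- The headway stays nonnegative over one step from any state of `R_K`, whatever the input. -/
theorem gcon_dyn_nonpos {M : ℕ} {Ts amin cmin vmax : ℝ} (hTs : 0 ≤ Ts) (c : Fin M → ℝ)
    {x : ℝ × ℝ × ℝ} (hx : x ∈ RK amin cmin vmax) (u : ℝ) (w : Fin M) :
    gcon (dyn Ts c x u w) ≤ 0 := by
  obtain ⟨-, -, h, -, h₁⟩ := hx
  exact neg_nonpos.2 (add_nonneg h₁ (mul_nonneg hTs (sub_nonneg.2 h)))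

/-- The linear feedback `u = c_min·x₂` is admissible on `R_K`. -/
theorem feedback_mem_Uset {amin amax cmin vmax : ℝ} (hc : cmin < 0) (hamax : 0 ≤ amax)
    {x : ℝ × ℝ × ℝ} (hx : x ∈ RK amin cmin vmax) : cmin * x.2.1 ∈ Uset amin amax := by
  obtain ⟨h, h₀, -⟩ := hx
  refine ⟨?_, (mul_nonpos_of_nonpos_of_nonneg hc.le h₀).trans hamax⟩
  rw [mul_comm]
  exact (le_div_iff_of_neg hc).1 h

/-- Every `x ∈ R_K` lies in `X_r`, and the input `u = c_min·x₂ ∈ U` renders the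
risk constraint satisfied for *every* probability vector `p`; in particular
`R_K × W ⊆ Z_s`. -/
theorem rk_subset_stochastic_feasibility {M : ℕ} (Ts cmin amin amax vmax δ : ℝ)
    (c : Fin M → ℝ) (P : Fin M → Fin M → ℝ)
    (hTs : 0 < Ts) (hc1 : -(1 / Ts) ≤ cmin) (hc2 : cmin < 0)
    (hcw : ∀ w : Fin M, cmin ≤ c w)
    (hamin : amin ≤ 0) (hamax : 0 ≤ amax) (hvmax : 0 < vmax)
    (hδ : 0 < δ) (hδ1 : δ ≤ 1)
    (hP : ∀ j : Fin M, P j ∈ simplex M)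
    (x : ℝ × ℝ × ℝ) (hx : x ∈ RK amin cmin vmax) (w : Fin M) :
    x ∈ Xr vmax ∧
    (cmin * x.2.1 ∈ Uset amin amax ∧
      ∀ p ∈ simplex M,
        avar δ p (fun w' => gcon (dyn Ts c x (cmin * x.2.1) w')) ≤ 0) ∧
    (x, w) ∈ Zs Ts c amin amax vmax δ P := by
  have hX : x ∈ Xr vmax := ⟨hx.2.1, hx.2.2.2.1⟩
  have hU := feedback_mem_Uset hc2 hamax hx
  have hrisk (p : Fin M → ℝ) :
      avar δ p (fun w' => gcon (dyn Ts c x (cmin * x.2.1) w')) ≤ 0 :=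
    avar_nonpos δ p (gcon_dyn_nonpos hTs.le c hx _)
  exact ⟨hX, ⟨hU, fun p _ => hrisk p⟩, hX, _, hU, hrisk (P w)⟩
end

section
/- (Nominal recursive feasibility.) Let W = {1, …, M}, let P be a row-stochastic M×M transition matrix, let δ ∈ (0, 1], and let X_N ⊆ ℝ³ be a robust control invariant set for the dynamics f with input set U, such that X_N × W ⊆ Z_s. Suppose the horizon-N optimal control problem is feasible at (x, w): there exist inputs u^σ ∈ U and states x^σ ∈ ℝ³ indexed by mode sequences σ = (w₁, …, w_k) ∈ W^k of positive probability starting from w (i.e., P_{w,w₁} > 0 and P_{w_{i},w_{i+1}} > 0 for all i), for k = 0, …, N, such that x^∅ = x, x^{(w₁,…,w_k)} = f(x^{(w₁,…,w_{k−1})}, u^{(w₁,…,w_{k−1})}, w_k), x^σ ∈ X_r for all σ with k ≤ N−1, AVaR_δ^{P_{w_k}}[(g(f(x^σ, u^σ, w')))_{w' ∈ W}] ≤ 0 for all σ with k ≤ N−1 (with w₀ := w), and x^σ ∈ X_N for all σ of length N. Then for every w' ∈ W with P_{w,w'} > 0, the optimal control problem is feasible at (f(x, u^∅, w'), w'). 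-/
open scoped BigOperators

/-- Robust control invariance of a set `R` for the dynamics with input set `U`. -/
def RCI {M : ℕ} (Ts : ℝ) (c : Fin M → ℝ) (amin amax : ℝ) (R : Set (ℝ × ℝ × ℝ)) : Prop :=
  ∀ x ∈ R, ∃ u ∈ Uset amin amax, ∀ w : Fin M, dyn Ts c x u w ∈ R

/-- `Adm P w σ` : the mode sequence `σ = [w₁, …, w_k]` has positive probability
starting from `w`, i.e. `P w w₁ > 0` and `P wᵢ wᵢ₊₁ > 0` for all `i`. -/
def Adm {M : ℕ} (P : Fin M → Fin M → ℝ) : Fin M → List (Fin M) → Prop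
  | _, [] => True
  | w, w₁ :: rest => 0 < P w w₁ ∧ Adm P w₁ rest

/-- Last mode of the sequence `w :: σ`. -/
def lastMode {M : ℕ} (w : Fin M) (σ : List (Fin M)) : Fin M := σ.getLastD w

/-- Feasibility of the horizon-`N` nominal stochastic optimal control problem at
`(x₀, w)`: there exist inputs and states, indexed by mode sequences of positive
probability starting from `w`, satisfying the system dynamics, the input/state
constraints, the `AVaR` risk constraints, and the terminal constraint `X_N`. -/
noncomputable def Feasible {M : ℕ} (Ts : ℝ) (c : Fin M → ℝ) (amin amax vmax δ : ℝ)
    (P : Fin M → Fin M → ℝ) (XN : Set (ℝ × ℝ × ℝ)) (N : ℕ)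
    (x0 : ℝ × ℝ × ℝ) (w : Fin M) : Prop :=
  ∃ (u : List (Fin M) → ℝ) (xs : List (Fin M) → ℝ × ℝ × ℝ),
    xs [] = x0 ∧
    (∀ (σ : List (Fin M)) (w' : Fin M), Adm P w (σ ++ [w']) → σ.length < N →
      xs (σ ++ [w']) = dyn Ts c (xs σ) (u σ) w') ∧
    (∀ σ : List (Fin M), Adm P w σ → σ.length < N →
      u σ ∈ Uset amin amax ∧ xs σ ∈ Xr vmax ∧
      avar δ (P (lastMode w σ)) (fun w' => gcon (dyn Ts c (xs σ) (u σ) w')) ≤ 0) ∧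
    (∀ σ : List (Fin M), Adm P w σ → σ.length = N → xs σ ∈ XN)

/-- A prefix of an admissible mode sequence is admissible. -/
lemma Adm.of_append {M : ℕ} {P : Fin M → Fin M → ℝ} {σ τ : List (Fin M)} {w : Fin M}
    (h : Adm P w (σ ++ τ)) : Adm P w σ := by
  induction σ generalizing w with
  | nil => trivial
  | cons a σ ih => exact ⟨h.1, ih h.2⟩

lemma lastMode_cons {M : ℕ} (w a : Fin M) (σ : List (Fin M)) :
    lastMode w (a :: σ) = lastMode a σ :=
  List.getLastD_cons ..

/-- The first coordinate of the successor state does not depend on the input. -/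
lemma gcon_dyn_eq {M : ℕ} (Ts : ℝ) (c : Fin M → ℝ) (x : ℝ × ℝ × ℝ) (u v : ℝ) (w : Fin M) :
    gcon (dyn Ts c x u w) = gcon (dyn Ts c x v w) := rfl

/-- **Nominal recursive feasibility.** If `X_N` is robust control invariant with
`X_N × W ⊆ Z_s`, and the nominal OCP is feasible at `(x, w)` with first input
`u []`, then for every `w'` with `P w w' > 0`, the OCP is feasible at
`(f(x, u [], w'), w')`. -/
theorem nominal_recursive_feasibility {M : ℕ} (Ts : ℝ) (c : Fin M → ℝ)
    (amin amax vmax δ : ℝ) (P : Fin M → Fin M → ℝ)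
    (XN : Set (ℝ × ℝ × ℝ)) (N : ℕ) (hN : 1 ≤ N)
    (hTs : 0 < Ts) (hamin : amin ≤ 0) (hamax : 0 ≤ amax) (hvmax : 0 < vmax)
    (hδ : 0 < δ) (hδ1 : δ ≤ 1)
    (hP : ∀ j : Fin M, P j ∈ simplex M)
    (hXN : RCI Ts c amin amax XN)
    (hXNZs : ∀ y ∈ XN, ∀ j : Fin M, (y, j) ∈ Zs Ts c amin amax vmax δ P)
    (x : ℝ × ℝ × ℝ) (w : Fin M)
    (u : List (Fin M) → ℝ) (xs : List (Fin M) → ℝ × ℝ × ℝ)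
    (hinit : xs [] = x)
    (hdyn : ∀ (σ : List (Fin M)) (w' : Fin M), Adm P w (σ ++ [w']) → σ.length < N →
      xs (σ ++ [w']) = dyn Ts c (xs σ) (u σ) w')
    (hstage : ∀ σ : List (Fin M), Adm P w σ → σ.length < N →
      u σ ∈ Uset amin amax ∧ xs σ ∈ Xr vmax ∧
      avar δ (P (lastMode w σ)) (fun w' => gcon (dyn Ts c (xs σ) (u σ) w')) ≤ 0)
    (hterm : ∀ σ : List (Fin M), Adm P w σ → σ.length = N → xs σ ∈ XN) :
    ∀ w' : Fin M, 0 < P w w' →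
      Feasible Ts c amin amax vmax δ P XN N (dyn Ts c x (u []) w') w' := by
  intro w' hw'
  choose! κ hκU hκ using hXN
  have hadm {σ : List (Fin M)} (h : Adm P w' σ) : Adm P w (w' :: σ) := ⟨hw', h⟩
  have hlast {σ : List (Fin M)} (h : Adm P w' σ) (hl : σ.length + 1 = N) :
      xs (w' :: σ) ∈ XN := hterm _ (hadm h) hl
  refine ⟨fun σ => if σ.length + 1 < N then u (w' :: σ) else κ (xs (w' :: σ)),
    fun σ => if σ.length < N then xs (w' :: σ) else
      dyn Ts c (xs (w' :: σ.dropLast)) (κ (xs (w' :: σ.dropLast))) (lastMode w' σ),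
    ?_, ?_, ?_, ?_⟩
  · have h := hdyn [] w' ⟨hw', trivial⟩ hN
    rw [hinit] at h
    simpa [Nat.lt_of_succ_le hN] using h
  · intro σ a hσ hl
    by_cases h : σ.length + 1 < N
    · simpa [h, hl] using hdyn (w' :: σ) a (hadm hσ) h
    · simp [h, hl, lastMode, List.getLastD_eq_getLast?]
  · intro σ hσ hl
    by_cases h : σ.length + 1 < N
    · simpa only [h, hl, if_true, lastMode_cons] using hstage (w' :: σ) (hadm hσ) h
    · have hx := hlast hσ (by omega)
      obtain ⟨hr, v, -, hv⟩ := hXNZs _ hx (lastMode w' σ)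
      simp only [h, hl, if_true, if_false]
      refine ⟨hκU _ hx, hr, ?_⟩
      simpa only [gcon_dyn_eq Ts c _ _ v] using hv
  · intro σ hσ hl
    obtain rfl | ⟨τ, a, rfl⟩ := σ.eq_nil_or_concat
    · simp at hl
      omega
    · rw [List.concat_eq_append] at hσ hl ⊢
      simp only [hl, lt_irrefl, if_false, List.dropLast_concat]
      exact hκ _ (hlast hσ.of_append (by simpa using hl)) _
end

section
/- Let z ∈ ℝ^n, δ ∈ (0, 1], r ≥ 0, p̂ ∈ Δ_n, and let A_r(p̂) = {p ∈ Δ_n : ‖p − p̂‖₁ ≤ r}. If the true probability vector p lies in A_r(p̂) and TVAVAR_δ^{A_r(p̂)}[z] ≤ 0, then AVaR_δ^p[z] ≤ 0 and consequently Σ_{i : zᵢ > 0} pᵢ ≤ δ, i.e., the chance constraint P[z ≤ 0] ≥ 1 − δ holds under the true distribution. -/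
open scoped BigOperators

/-- Distributionally robust average value-at-risk over an ambiguity set `A`. -/
noncomputable def tvavar {n : ℕ} (δ : ℝ) (A : Set (Fin n → ℝ)) (z : Fin n → ℝ) : ℝ :=
  sSup {v | ∃ ν ∈ A, v = avar δ ν z}

/-- `ℓ₁`-ambiguity ball of radius `r` around `p̂` inside the simplex. -/
def ambBall {n : ℕ} (r : ℝ) (phat : Fin n → ℝ) : Set (Fin n → ℝ) :=
  {p ∈ simplex n | (∑ i, |p i - phat i|) ≤ r}

/-- A weighted average with nonnegative weights of total mass one is at most `∑ i, |z i|`. -/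
theorem sum_mul_le_sum_abs {ι : Type*} [Fintype ι] {μ z : ι → ℝ}
    (hsum : ∑ i, μ i = 1) (hμ : ∀ i, 0 ≤ μ i) : ∑ i, μ i * z i ≤ ∑ i, |z i| := by
  refine Finset.sum_le_sum fun i _ => ?_
  have hle : μ i ≤ 1 := hsum ▸ Finset.single_le_sum (fun j _ => hμ j) (Finset.mem_univ i)
  calc μ i * z i ≤ μ i * |z i| := mul_le_mul_of_nonneg_left (le_abs_self _) (hμ i)
    _ ≤ |z i| := mul_le_of_le_one_left (abs_nonneg _) hle

theorem avar_le_sum_abs {n : ℕ} (δ : ℝ) (p z : Fin n → ℝ) : avar δ p z ≤ ∑ i, |z i| := by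
  refine Real.sSup_le ?_ (Finset.sum_nonneg fun i _ => abs_nonneg _)
  rintro v ⟨μ, hsum, hμ, rfl⟩
  exact sum_mul_le_sum_abs hsum fun i => (hμ i).1

theorem sum_mul_le_avar {n : ℕ} {δ : ℝ} {p z μ : Fin n → ℝ} (hsum : ∑ i, μ i = 1)
    (hμ : ∀ i, 0 ≤ μ i ∧ μ i ≤ p i / δ) : ∑ i, μ i * z i ≤ avar δ p z := by
  refine le_csSup ⟨∑ i, |z i|, ?_⟩ ⟨μ, hsum, hμ, rfl⟩
  rintro v ⟨ν, hν, hν', rfl⟩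
  exact sum_mul_le_sum_abs hν fun i => (hν' i).1

theorem avar_le_tvavar {n : ℕ} (δ : ℝ) {A : Set (Fin n → ℝ)} {p : Fin n → ℝ} (hp : p ∈ A)
    (z : Fin n → ℝ) : avar δ p z ≤ tvavar δ A z := by
  refine le_csSup ⟨∑ i, |z i|, ?_⟩ ⟨p, hp, rfl⟩
  rintro v ⟨ν, -, rfl⟩
  exact avar_le_sum_abs δ ν z

/-- If the event `{z > 0}` has probability more than `δ`, then conditioning on it is feasible
in the dual representation of the average value-at-risk, which is therefore positive. -/
theorem avar_pos_of_lt_sum {n : ℕ} {δ : ℝ} (hδ : 0 < δ) {p z : Fin n → ℝ} (hp : ∀ i, 0 ≤ p i)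
    (hlt : δ < ∑ i ∈ Finset.univ.filter fun i => 0 < z i, p i) : 0 < avar δ p z := by
  set P := ∑ i ∈ Finset.univ.filter fun i => 0 < z i, p i with hP
  have hP0 : 0 < P := hδ.trans hlt
  let μ : Fin n → ℝ := fun i => if 0 < z i then p i / P else 0
  have hsum : ∑ i, μ i = 1 := by
    rw [← Finset.sum_filter, ← Finset.sum_div, ← hP, div_self hP0.ne']
  have hμ : ∀ i, 0 ≤ μ i ∧ μ i ≤ p i / δ := by
    intro i
    by_cases hi : 0 < z i
    · simp only [μ, if_pos hi]
      exact ⟨div_nonneg (hp i) hP0.le, div_le_div_of_nonneg_left (hp i) hδ hlt.le⟩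
    · simp only [μ, if_neg hi]
      exact ⟨le_rfl, div_nonneg (hp i) hδ.le⟩
  refine lt_of_lt_of_le ?_ (sum_mul_le_avar hsum hμ)
  obtain ⟨j, hj, hpj⟩ := Finset.exists_lt_of_sum_lt (f := fun _ => (0 : ℝ)) (g := p)
    (s := Finset.univ.filter fun i => 0 < z i) (by simpa using hP0)
  have hzj : 0 < z j := (Finset.mem_filter.mp hj).2
  refine Finset.sum_pos' (fun i _ => ?_) ⟨j, Finset.mem_univ j, ?_⟩
  · by_cases hi : 0 < z i
    · exact mul_nonneg (hμ i).1 hi.le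
    · simp [μ, hi]
  · simp only [μ, if_pos hzj]
    exact mul_pos (div_pos hpj hP0) hzj

/-- If the true distribution `p` lies in the `ℓ₁`-ambiguity ball `A_r(p̂)` and
`TVAVAR_δ^{A_r(p̂)}[z] ≤ 0`, then `AVaR_δ^p[z] ≤ 0` and consequently the chance
constraint holds under `p`: the `p`-probability of `{z > 0}` is at most `δ`. -/
theorem tvavar_le_zero_implies_chance_constraint {n : ℕ} (z : Fin n → ℝ)
    (δ r : ℝ) (hδ : 0 < δ) (hδ1 : δ ≤ 1) (hr : 0 ≤ r)
    (phat : Fin n → ℝ) (hphat : phat ∈ simplex n)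
    (p : Fin n → ℝ) (hp : p ∈ ambBall r phat)
    (h : tvavar δ (ambBall r phat) z ≤ 0) :
    avar δ p z ≤ 0 ∧ (∑ i ∈ Finset.univ.filter fun i => 0 < z i, p i) ≤ δ := by
  have havar : avar δ p z ≤ 0 := (avar_le_tvavar δ hp z).trans h
  exact ⟨havar, le_of_not_gt fun hlt => (avar_pos_of_lt_sum hδ hp.1.2 hlt).not_ge havar⟩
end
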